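/- arXiv:2307.16817 — 2 statements merged into one kernel-verified Lean document; each statement's English description precedes it below -/
import Mathlib

section
/- Let n ≥ 1, let f : ℝ^n → ℂ be a smooth compactly supported function, and let y ∈ ℝ^n. Then lim_{λ→+∞} lim_{ε→0+} ∫_{ℝ^n} f(x) e^{iλ Σ_{k=1}^n (x_k − y_k)} / Π_{k=1}^{n} (x_k − y_k − iε) dx = (2πi)^n f(y_1, …, y_n). -/
open Finset Filter MeasureTheory Complex

/-- Fourier data of the test function, centred at `y`. -/
theorem aux_fourier (n : ℕ)
    (f : (Fin n → ℝ) → ℂ) (hf : ContDiff ℝ (⊤ : ℕ∞) f) (hfc : HasCompactSupport f)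
    (y : Fin n → ℝ) :
    ∃ G : (Fin n → ℝ) → ℂ, Integrable G ∧ ∫ w, G w = f y ∧
      ∀ w, G w = ∫ x : Fin n → ℝ,
        f x * cexp (-(2 * (Real.pi : ℂ) * I) * ((∑ k, (x k - y k) * w k : ℝ) : ℂ)) := by
  have hmp := PiLp.volume_preserving_toLp (Fin n)
  have hme : MeasurableEmbedding (WithLp.toLp 2 : (Fin n → ℝ) → EuclideanSpace ℝ (Fin n)) :=
    (MeasurableEquiv.toLp 2 (Fin n → ℝ)).measurableEmbedding
  let e : EuclideanSpace ℝ (Fin n) ≃L[ℝ] (Fin n → ℝ) := EuclideanSpace.equiv (Fin n) ℝ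
  have hg1 : HasCompactSupport (fun v : EuclideanSpace ℝ (Fin n) => f (e v + y)) :=
    hfc.comp_homeomorph (e.toHomeomorph.trans (Homeomorph.addRight y))
  have hg2 : ContDiff ℝ (⊤ : ℕ∞) (fun v : EuclideanSpace ℝ (Fin n) => f (e v + y)) :=
    hf.comp (e.contDiff.add contDiff_const)
  let S := hg1.toSchwartzMap hg2
  have hS : ∀ v, S v = f (e v + y) := fun v => rfl
  let T := FourierTransform.fourier S
  refine ⟨fun w => T (WithLp.toLp 2 w), ?_, ?_, ?_⟩
  · exact (hmp.integrable_comp_emb hme).2 T.integrable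
  · rw [hmp.integral_comp hme (fun v => T v)]
    have h1 : FourierTransformInv.fourierInv T = S :=
      FourierTransform.fourierInv_fourier_eq S
    have h2 := congrArg (fun s => s 0) h1
    rw [SchwartzMap.fourierInv_coe, Real.fourierInv_eq', hS] at h2
    simpa using h2
  · intro w
    have : T (WithLp.toLp 2 w) = FourierTransform.fourier (S : EuclideanSpace ℝ (Fin n) → ℂ)
      (WithLp.toLp 2 w) := by rw [← SchwartzMap.fourier_coe]
    simp only [this]
    rw [Real.fourier_eq', ← hmp.integral_comp hme,
      ← integral_add_right_eq_self (μ := (volume : Measure (Fin n → ℝ)))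
        (fun x => f x * cexp (-(2 * (Real.pi : ℂ) * I) * ((∑ k, (x k - y k) * w k : ℝ) : ℂ))) y]
    refine integral_congr_ae (Eventually.of_forall fun x => ?_)
    simp only [hS]
    rw [smul_eq_mul, mul_comm]
    congr 2
    simp [PiLp.inner_apply, mul_comm (w _ : ℂ)]
    ring

/-- The regularising factor. -/
noncomputable def auxK (n : ℕ) (eps : ℝ) (w : Fin n → ℝ) : ℂ :=
  ∏ k, (Set.Ioi (0 : ℝ)).indicator (fun t : ℝ => cexp (-(2 * (Real.pi : ℂ) * eps) * t)) (w k)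

theorem auxK_meas (n : ℕ) (eps : ℝ) : Measurable (auxK n eps) := by
  unfold auxK
  refine Finset.measurable_prod _ fun k _ => ?_
  have : Measurable ((Set.Ioi (0 : ℝ)).indicator
      (fun t : ℝ => cexp (-(2 * (Real.pi : ℂ) * eps) * t))) :=
    Measurable.indicator (by fun_prop) measurableSet_Ioi
  exact this.comp (measurable_pi_apply k)

theorem auxK_int (n : ℕ) (eps : ℝ) (h : 0 < eps) : Integrable (auxK n eps) := by
  unfold auxK
  refine Integrable.fintype_prod (f := fun _ : Fin n => (Set.Ioi (0 : ℝ)).indicator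
      (fun t : ℝ => cexp (-(2 * (Real.pi : ℂ) * eps) * t))) fun k => ?_
  rw [integrable_indicator_iff measurableSet_Ioi]
  apply integrableOn_exp_mul_complex_Ioi
  simp
  positivity

theorem auxK_norm (n : ℕ) (eps : ℝ) (h : 0 ≤ eps) (w : Fin n → ℝ) : ‖auxK n eps w‖ ≤ 1 := by
  unfold auxK
  rw [norm_prod]
  refine Finset.prod_le_one (fun _ _ => norm_nonneg _) fun k _ => ?_
  by_cases hk : w k ∈ Set.Ioi (0 : ℝ)
  · rw [Set.indicator_of_mem hk, Complex.norm_exp, Real.exp_le_one_iff]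
    have : (0 : ℝ) < w k := hk
    simp
    positivity
  · rw [Set.indicator_of_notMem hk]; simp

theorem auxK_tendsto (n : ℕ) (w : Fin n → ℝ) :
    Tendsto (fun eps => auxK n eps w) (nhdsWithin 0 (Set.Ioi 0)) (nhds (auxK n 0 w)) := by
  have : Continuous (fun eps => auxK n eps w) := by
    unfold auxK
    refine continuous_finsetProd _ fun k _ => ?_
    by_cases hk : w k ∈ Set.Ioi (0 : ℝ)
    · simp only [Set.indicator_of_mem hk]; fun_prop
    · simp only [Set.indicator_of_notMem hk]; fun_prop
  exact (this.tendsto 0).mono_left nhdsWithin_le_nhds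

theorem auxK_kernel (n : ℕ) (eps : ℝ) (h : 0 < eps) (u : Fin n → ℝ) :
    (∏ k, ((u k : ℂ) - I * eps))⁻¹ = (2 * (Real.pi : ℂ) * I) ^ n *
      ∫ w, auxK n eps w * cexp (-(2 * (Real.pi : ℂ) * I) * ((∑ k, u k * w k : ℝ) : ℂ)) := by
  have h1 : ∀ w : Fin n → ℝ,
      auxK n eps w * cexp (-(2 * (Real.pi : ℂ) * I) * ((∑ k, u k * w k : ℝ) : ℂ)) =
      ∏ k, (Set.Ioi (0 : ℝ)).indicator
        (fun t : ℝ => cexp (-(2 * (Real.pi : ℂ) * (I * u k + eps)) * t)) (w k) := by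
    intro w
    unfold auxK
    push_cast
    rw [Finset.mul_sum, Complex.exp_sum, ← Finset.prod_mul_distrib]
    refine Finset.prod_congr rfl fun k _ => ?_
    by_cases hk : w k ∈ Set.Ioi (0 : ℝ)
    · rw [Set.indicator_of_mem hk, Set.indicator_of_mem hk, ← Complex.exp_add]
      congr 1; ring
    · rw [Set.indicator_of_notMem hk, Set.indicator_of_notMem hk, zero_mul]
  simp_rw [h1]
  rw [integral_fintype_prod_volume_eq_prod (fun k : Fin n => (Set.Ioi (0 : ℝ)).indicator
        (fun t : ℝ => cexp (-(2 * (Real.pi : ℂ) * (I * u k + eps)) * t)))]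
  have h2 : (2 * (Real.pi : ℂ) * I) ^ n = ∏ _k : Fin n, (2 * (Real.pi : ℂ) * I) := by simp
  rw [h2, ← Finset.prod_mul_distrib, ← Finset.prod_inv_distrib]
  refine Finset.prod_congr rfl fun k _ => ?_
  rw [integral_indicator measurableSet_Ioi, integral_exp_mul_complex_Ioi]
  · have hpi : (Real.pi : ℂ) ≠ 0 := by exact_mod_cast Real.pi_ne_zero
    have hne : (u k : ℂ) - I * eps ≠ 0 := by
      intro h0
      have := congrArg Complex.im h0
      simp at this
      exact h.ne' this
    have e1 : I * (u k : ℂ) + eps = I * ((u k : ℂ) - I * eps) := by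
      linear_combination (eps : ℂ) * Complex.I_mul_I
    rw [e1]
    have := Complex.I_ne_zero
    simp
    field_simp
    simp [Complex.I_sq]
  · simp
    positivity

theorem auxMain (n : ℕ) (f : (Fin n → ℝ) → ℂ) (hfi : Integrable f) (y : Fin n → ℝ)
    (G : (Fin n → ℝ) → ℂ)
    (hG : ∀ w, G w = ∫ x : Fin n → ℝ,
        f x * cexp (-(2 * (Real.pi : ℂ) * I) * ((∑ k, (x k - y k) * w k : ℝ) : ℂ)))
    (lam eps : ℝ) (h : 0 < eps) :
    ∫ x : Fin n → ℝ,
      f x * Complex.exp (Complex.I * (lam : ℂ) * ((∑ k, (x k - y k) : ℝ) : ℂ))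
        / ∏ k : Fin n, (((x k : ℝ) : ℂ) - ((y k : ℝ) : ℂ) - Complex.I * (eps : ℂ)) =
    (2 * (Real.pi : ℂ) * I) ^ n *
      ∫ w, auxK n eps w * G (fun k => w k - lam / (2 * Real.pi)) := by
  have hpi : (Real.pi : ℂ) ≠ 0 := by exact_mod_cast Real.pi_ne_zero
  let P : (Fin n → ℝ) → (Fin n → ℝ) → ℂ := fun x w =>
    cexp (-(2 * (Real.pi : ℂ) * I) * ((∑ k, (x k - y k) * (w k - lam / (2 * Real.pi)) : ℝ) : ℂ))
  have hP : ∀ x w, P x w = cexp (I * lam * ((∑ k, (x k - y k) : ℝ) : ℂ)) *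
      cexp (-(2 * (Real.pi : ℂ) * I) * ((∑ k, (x k - y k) * w k : ℝ) : ℂ)) := by
    intro x w
    simp only [P]
    rw [← Complex.exp_add]
    congr 1
    simp only [mul_sub, Finset.sum_sub_distrib, ← Finset.sum_mul]
    push_cast
    field_simp
    ring
  have hint : Integrable (fun p : (Fin n → ℝ) × (Fin n → ℝ) =>
      (f p.1 * auxK n eps p.2) * P p.1 p.2) (volume.prod volume) := by
    refine Integrable.mul_bdd (c := 1) (hfi.mul_prod (auxK_int n eps h)) ?_ ?_
    · refine Continuous.aestronglyMeasurable ?_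
      simp only [P]
      fun_prop
    · refine Eventually.of_forall fun p => ?_
      simp only [P]
      rw [Complex.norm_exp, Real.exp_le_one_iff]
      rw [Complex.mul_re, Complex.ofReal_re, Complex.ofReal_im]
      simp
  have hL : ∀ x : Fin n → ℝ,
      f x * Complex.exp (Complex.I * (lam : ℂ) * ((∑ k, (x k - y k) : ℝ) : ℂ))
        / ∏ k : Fin n, (((x k : ℝ) : ℂ) - ((y k : ℝ) : ℂ) - Complex.I * (eps : ℂ)) =
      (2 * (Real.pi : ℂ) * I) ^ n * ∫ w, (f x * auxK n eps w) * P x w := by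
    intro x
    have := auxK_kernel n eps h (fun k => x k - y k)
    simp only [Complex.ofReal_sub] at this
    rw [div_eq_mul_inv, this, mul_left_comm, ← integral_const_mul]
    congr 2
    funext w
    rw [hP]
    ring
  simp_rw [hL]
  rw [integral_const_mul, integral_integral_swap hint]
  congr 2
  funext w
  rw [hG, ← integral_const_mul]
  congr 1
  funext x
  simp only [P]
  ring

theorem delta_sequence_diagonal (n : ℕ) (hn : 1 ≤ n)
    (f : (Fin n → ℝ) → ℂ) (hf : ContDiff ℝ (⊤ : ℕ∞) f) (hfc : HasCompactSupport f)
    (y : Fin n → ℝ) :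
    ∃ L : ℝ → ℂ,
      (∀ lam : ℝ, 0 < lam →
        Tendsto (fun eps : ℝ =>
            ∫ x : Fin n → ℝ,
              f x * Complex.exp (Complex.I * (lam : ℂ) * ((∑ k, (x k - y k) : ℝ) : ℂ))
                / ∏ k : Fin n, (((x k : ℝ) : ℂ) - ((y k : ℝ) : ℂ) - Complex.I * (eps : ℂ)))
          (nhdsWithin 0 (Set.Ioi 0)) (nhds (L lam))) ∧
      Tendsto L atTop (nhds ((2 * (Real.pi : ℂ) * Complex.I) ^ n * f y)) := by
  obtain ⟨G, hGi, hGy, hG⟩ := aux_fourier n f hf hfc y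
  have hfi : Integrable f := hf.continuous.integrable_of_hasCompactSupport hfc
  refine ⟨fun lam => (2 * (Real.pi : ℂ) * Complex.I) ^ n *
    ∫ w, auxK n 0 w * G (fun k => w k - lam / (2 * Real.pi)), ?_, ?_⟩
  · intro lam _
    have hGs : Integrable (fun w : Fin n → ℝ => G (fun k => w k - lam / (2 * Real.pi))) :=
      hGi.comp_sub_right (fun _ => lam / (2 * Real.pi))
    have key : Tendsto (fun eps => (2 * (Real.pi : ℂ) * Complex.I) ^ n *
        ∫ w, auxK n eps w * G (fun k => w k - lam / (2 * Real.pi)))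
        (nhdsWithin 0 (Set.Ioi 0)) (nhds ((2 * (Real.pi : ℂ) * Complex.I) ^ n *
        ∫ w, auxK n 0 w * G (fun k => w k - lam / (2 * Real.pi)))) := by
      refine Tendsto.const_mul _ ?_
      refine tendsto_integral_filter_of_dominated_convergence
        (fun w => ‖G (fun k => w k - lam / (2 * Real.pi))‖) ?_ ?_ hGs.norm ?_
      · exact Eventually.of_forall fun eps =>
          (auxK_meas n eps).aestronglyMeasurable.mul hGs.aestronglyMeasurable
      · filter_upwards [self_mem_nhdsWithin] with eps heps
        refine Eventually.of_forall fun w => ?_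
        rw [norm_mul]
        exact mul_le_of_le_one_left (norm_nonneg _) (auxK_norm n eps (le_of_lt heps) w)
      · exact Eventually.of_forall fun w => (auxK_tendsto n w).mul_const _
    refine key.congr' ?_
    filter_upwards [self_mem_nhdsWithin] with eps heps
    exact (auxMain n f hfi y G hG lam eps heps).symm
  · refine Tendsto.const_mul _ ?_
    rw [← hGy]
    have hsh : ∀ lam : ℝ, ∫ w, auxK n 0 w * G (fun k => w k - lam / (2 * Real.pi)) =
        ∫ w, auxK n 0 (w + fun _ => lam / (2 * Real.pi)) * G w := by
      intro lam
      rw [← integral_add_right_eq_self (μ := (volume : Measure (Fin n → ℝ))) _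
        (fun _ => lam / (2 * Real.pi))]
      simp
    simp_rw [hsh]
    refine tendsto_integral_filter_of_dominated_convergence (fun w => ‖G w‖) ?_ ?_ hGi.norm ?_
    · exact Eventually.of_forall fun lam =>
        ((auxK_meas n 0).comp (measurable_add_const _)).aestronglyMeasurable.mul
          hGi.aestronglyMeasurable
    · refine Eventually.of_forall fun lam => Eventually.of_forall fun w => ?_
      rw [norm_mul]
      exact mul_le_of_le_one_left (norm_nonneg _) (auxK_norm n 0 le_rfl _)
    · refine Eventually.of_forall fun w => ?_
      refine tendsto_const_nhds.congr' ?_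
      have hev : ∀ᶠ lam : ℝ in atTop, ∀ k, 0 < w k + lam / (2 * Real.pi) := by
        rw [Filter.eventually_all]
        intro k
        have : Tendsto (fun lam : ℝ => w k + lam / (2 * Real.pi)) atTop atTop :=
          tendsto_atTop_add_const_left _ _ (tendsto_id.atTop_div_const (by positivity))
        exact this.eventually_gt_atTop 0
      filter_upwards [hev] with lam hlam
      have : auxK n 0 (w + fun _ => lam / (2 * Real.pi)) = 1 := by
        unfold auxK
        refine Finset.prod_eq_one fun k _ => ?_
        rw [Set.indicator_of_mem (by simpa using hlam k)]
        simp
      rw [this, one_mul]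
end

section
/- Let f : ℝ → ℂ be a smooth compactly supported function and let y ∈ ℝ. Then lim_{λ→+∞} lim_{ε→0+} ∫_ℝ f(x) e^{iλ(x − y)} / (x − y − iε) dx = 2πi f(y). -/
open Filter MeasureTheory Complex

/-- The kernel: `1/(u - iε)` times the oscillating factor, as a Laplace-type integral. -/
lemma sp_kernel (a eps u : ℝ) (he : 0 < eps) (lam : ℝ) (hl : lam = 2 * Real.pi * a) (c : ℂ) :
    c * Complex.exp (Complex.I * (lam : ℂ) * (u : ℂ)) / ((u : ℂ) - Complex.I * (eps : ℂ)) =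
      ∫ w in Set.Ioi (-a), 2 * (Real.pi : ℂ) * Complex.I *
        (Complex.exp (((-(2 * Real.pi * eps * (w + a)) : ℝ)) : ℂ) *
          (Complex.exp (((-2 * Real.pi * w * u : ℝ) : ℂ) * Complex.I) * c)) := by
  have hz : (u : ℂ) - Complex.I * (eps : ℂ) ≠ 0 := by
    intro h
    have := congrArg Complex.im h
    simp at this
    linarith
  have hpi : (Real.pi : ℂ) ≠ 0 := by exact_mod_cast Real.pi_ne_zero
  set z : ℂ := (u : ℂ) - Complex.I * (eps : ℂ) with hzdef
  have hre : (-(2 * (Real.pi : ℂ) * Complex.I * z)).re < 0 := by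
    simp [hzdef]
    positivity
  have h1 : ∀ w : ℝ, 2 * (Real.pi : ℂ) * Complex.I *
        (Complex.exp (((-(2 * Real.pi * eps * (w + a)) : ℝ)) : ℂ) *
          (Complex.exp (((-2 * Real.pi * w * u : ℝ) : ℂ) * Complex.I) * c)) =
      (2 * (Real.pi : ℂ) * Complex.I * c * Complex.exp (-(2 * Real.pi * eps * a : ℂ))) *
        Complex.exp (-(2 * (Real.pi : ℂ) * Complex.I * z) * w) := by
    intro w
    have : Complex.exp (((-(2 * Real.pi * eps * (w + a)) : ℝ)) : ℂ) *
        Complex.exp (((-2 * Real.pi * w * u : ℝ) : ℂ) * Complex.I) =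
        Complex.exp (-(2 * Real.pi * eps * a : ℂ)) *
        Complex.exp (-(2 * (Real.pi : ℂ) * Complex.I * z) * w) := by
      rw [← Complex.exp_add, ← Complex.exp_add]
      congr 1
      rw [hzdef]
      push_cast
      linear_combination (-2 * (Real.pi : ℂ) * eps * w) * Complex.I_sq
    linear_combination (2 * (Real.pi : ℂ) * Complex.I * c) * this
  simp_rw [h1]
  rw [integral_const_mul, integral_exp_mul_complex_Ioi hre]
  have h2 : Complex.exp (Complex.I * (lam : ℂ) * (u : ℂ)) =
      Complex.exp (-(2 * Real.pi * eps * a : ℂ)) *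
      Complex.exp (-(2 * (Real.pi : ℂ) * Complex.I * z) * ((-a : ℝ) : ℂ)) := by
    rw [← Complex.exp_add]
    congr 1
    rw [hzdef, hl]
    push_cast
    linear_combination (2 * (Real.pi : ℂ) * eps * a) * Complex.I_sq
  rw [h2]
  field_simp

theorem sokhotski_plemelj_one_dim (f : ℝ → ℂ) (hf : ContDiff ℝ (⊤ : ℕ∞) f)
    (hfc : HasCompactSupport f) (y : ℝ) :
    ∃ L : ℝ → ℂ,
      (∀ lam : ℝ, 0 < lam →
        Tendsto (fun eps : ℝ =>
            ∫ x : ℝ,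
              f x * Complex.exp (Complex.I * (lam : ℂ) * ((x - y : ℝ) : ℂ))
                / (((x : ℝ) : ℂ) - ((y : ℝ) : ℂ) - Complex.I * (eps : ℂ)))
          (nhdsWithin 0 (Set.Ioi 0)) (nhds (L lam))) ∧
      Tendsto L atTop (nhds (2 * (Real.pi : ℂ) * Complex.I * f y)) := by
  have hfint : Integrable f := hf.continuous.integrable_of_hasCompactSupport hfc
  have hFint : Integrable (FourierTransform.fourier f) := by
    have := (FourierTransform.fourier (hfc.toSchwartzMap hf)).integrable (μ := volume)
    rw [SchwartzMap.fourier_coe] at this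
    exact this
  have hinv := congrFun (hf.continuous.fourierInv_fourier_eq hfint hFint) y
  set h : ℝ → ℂ := fun w =>
    Complex.exp (((2 * Real.pi * w * y : ℝ) : ℂ) * Complex.I) * FourierTransform.fourier f w with hh
  have hhint : Integrable h := by
    refine hFint.norm.mono' ?_ (ae_of_all _ fun w => ?_)
    · exact (Continuous.aestronglyMeasurable (by fun_prop)).mul hFint.aestronglyMeasurable
    · simp only [hh, norm_mul, Complex.norm_exp_ofReal_mul_I, one_mul, le_refl]
  have hhtot : ∫ w, h w = f y := by
    rw [← hinv, Real.fourierInv_eq']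
    refine integral_congr_ae (ae_of_all _ fun w => ?_)
    simp only [hh, smul_eq_mul, RCLike.inner_apply, conj_trivial]
    congr 4
    ring
  have hheq : ∀ w : ℝ, h w =
      ∫ x : ℝ, Complex.exp (((-2 * Real.pi * w * (x - y) : ℝ) : ℂ) * Complex.I) * f x := by
    intro w
    simp only [hh]
    rw [Real.fourier_real_eq_integral_exp_smul, ← integral_const_mul]
    refine integral_congr_ae (ae_of_all _ fun x => ?_)
    simp only [smul_eq_mul]
    rw [← mul_assoc, ← Complex.exp_add]
    congr 2
    push_cast
    ring
  refine ⟨fun lam => 2 * (Real.pi : ℂ) * Complex.I *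
    ∫ w in Set.Ioi (-(lam / (2 * Real.pi))), h w, ?_, ?_⟩
  · intro lam _
    set a := lam / (2 * Real.pi) with ha
    have hla : lam = 2 * Real.pi * a := by
      rw [ha]; field_simp
    have key : ∀ eps : ℝ, 0 < eps →
        ∫ x : ℝ, f x * Complex.exp (Complex.I * (lam : ℂ) * ((x - y : ℝ) : ℂ))
                / (((x : ℝ) : ℂ) - ((y : ℝ) : ℂ) - Complex.I * (eps : ℂ)) =
        2 * (Real.pi : ℂ) * Complex.I * ∫ w in Set.Ioi (-a),
          Complex.exp (((-(2 * Real.pi * eps * (w + a)) : ℝ)) : ℂ) * h w := by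
      intro eps he
      simp_rw [← Complex.ofReal_sub, fun x : ℝ => sp_kernel a eps (x - y) he lam hla (f x)]
      rw [integral_integral_swap, ← integral_const_mul]
      · refine integral_congr_ae (ae_of_all _ fun w => ?_)
        simp only
        rw [hheq, integral_const_mul, integral_const_mul]
      · have hexp : IntegrableOn
            (fun w : ℝ => Real.exp (-(2 * Real.pi * eps) * w)) (Set.Ioi (-a)) :=
          integrableOn_exp_mul_Ioi (by have := Real.pi_pos; nlinarith [mul_pos this he]) _
        have hp := (hfint.norm.mul_prod hexp).const_mul
          (2 * Real.pi * Real.exp (-(2 * Real.pi * eps * a)))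
        refine hp.mono' ?_ (ae_of_all _ fun p => le_of_eq ?_)
        · refine Continuous.aestronglyMeasurable ?_
          have := hf.continuous
          unfold Function.uncurry
          fun_prop
        · have e3 : Real.exp (-(2 * Real.pi * eps * (p.2 + a))) =
              Real.exp (-(2 * Real.pi * eps) * p.2) * Real.exp (-(2 * Real.pi * eps * a)) := by
            rw [← Real.exp_add]; ring_nf
          simp only [Function.uncurry, norm_mul, Complex.norm_exp_ofReal_mul_I, Complex.norm_I,
            Complex.norm_real, Complex.norm_exp_ofReal, Complex.norm_two,
            Real.norm_of_nonneg Real.pi_pos.le, e3]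
          ring
    refine Tendsto.congr' (f₁ := fun eps : ℝ => 2 * (Real.pi : ℂ) * Complex.I *
        ∫ w in Set.Ioi (-a),
          Complex.exp (((-(2 * Real.pi * eps * (w + a)) : ℝ)) : ℂ) * h w) ?_ ?_
    · filter_upwards [self_mem_nhdsWithin] with eps he
      exact (key eps he).symm
    · refine Tendsto.const_mul _ ?_
      refine tendsto_integral_filter_of_dominated_convergence (fun w => ‖h w‖) ?_ ?_
        hhint.norm.integrableOn ?_
      · refine Eventually.of_forall fun eps => ?_
        refine AEStronglyMeasurable.mul (Continuous.aestronglyMeasurable (by fun_prop)) ?_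
        exact hhint.aestronglyMeasurable.restrict
      · filter_upwards [self_mem_nhdsWithin] with eps he
        filter_upwards [ae_restrict_mem measurableSet_Ioi] with w hw
        rw [norm_mul, Complex.norm_exp_ofReal]
        refine mul_le_of_le_one_left (norm_nonneg _) (Real.exp_le_one_iff.2 ?_)
        have h1 : 0 < w + a := by have := Set.mem_Ioi.1 hw; linarith
        have h2 : 0 < eps := he
        have : 0 < 2 * Real.pi * eps * (w + a) := by positivity
        linarith
      · refine ae_of_all _ fun w => ?_
        refine tendsto_nhdsWithin_of_tendsto_nhds ?_
        have : Continuous fun eps : ℝ =>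
            Complex.exp (((-(2 * Real.pi * eps * (w + a)) : ℝ)) : ℂ) * h w := by fun_prop
        simpa using this.tendsto 0
  · refine Tendsto.const_mul _ ?_
    rw [← hhtot]
    refine (aecover_Ioi ?_).integral_tendsto_of_countably_generated hhint
    exact tendsto_neg_atTop_atBot.comp (tendsto_id.atTop_div_const (by positivity))
end
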